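/- Let G be a finite simple graph of maximum degree Δ, let H be a subgraph of G, and let c and c' be two proper partial (Δ+1)-edge colourings of G that agree on every edge not in H. For a given colouring, call a vertex x of G H-reaching if some Vizing chain constructed on x (with respect to that colouring) contains a vertex of H. Then the set of H-reaching vertices of G lying outside the 1-hop neighbourhood N¹(H) is the same for c and c', and this set has size at most 2·(Δ+1)³·|V(H)|. -/

import Mathlib

open SimpleGraph

variable {V : Type*}

/-- A colour `κ` is available at a vertex `v` if no edge incident to `v` is coloured `κ`. -/
def Available (G : SimpleGraph V) (c : Sym2 V → Option ℕ) (v : V) (κ : ℕ) : Prop :=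
  ∀ x, G.Adj v x → c s(v, x) ≠ some κ

/-- A proper partial edge colouring. -/
def IsProperPartial (G : SimpleGraph V) (c : Sym2 V → Option ℕ) : Prop :=
  (∀ e κ, c e = some κ → e ∈ G.edgeSet ∧ 1 ≤ κ) ∧
  ∀ e₁ e₂ κ, e₁ ≠ e₂ → (∃ z, z ∈ e₁ ∧ z ∈ e₂) → c e₁ = some κ → c e₂ ≠ some κ

/-- A proper partial `(Δ+1)`-edge colouring. -/
def IsProperPartialVizing (G : SimpleGraph V) [Fintype V] [DecidableRel G.Adj]
    (c : Sym2 V → Option ℕ) : Prop :=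
  IsProperPartial G c ∧ ∀ e κ, c e = some κ → κ ≤ G.maxDegree + 1

/-- `(u w 0, …, u w (k-1))` is a fan with center `u`. -/
def IsFan (G : SimpleGraph V) (c : Sym2 V → Option ℕ) (u : V) (w : ℕ → V) (k : ℕ) :
    Prop :=
  Set.InjOn w (Set.Iio k) ∧ (∀ i < k, G.Adj u (w i)) ∧ c s(u, w 0) = none ∧
  ∀ i, i + 1 < k → ∃ β, c s(u, w (i + 1)) = some β ∧ Available G c (w i) β

/-- A Vizing chain on an uncoloured edge `u v` with respect to `c`, constructed on the
vertex `u`. -/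
structure VizingChain (G : SimpleGraph V) (c : Sym2 V → Option ℕ) where
  u : V
  v : V
  w : ℕ → V
  k : ℕ
  κ₁ : ℕ
  κ₂ : ℕ
  x : ℕ → V
  t : ℕ
  k_pos : 1 ≤ k
  fan : IsFan G c u w k
  w0 : w 0 = v
  avail₁ : Available G c u κ₁
  avail₂ : Available G c (w (k - 1)) κ₂
  x0 : x 0 = w (k - 1)
  path_inj : Set.InjOn x (Set.Iic t)
  path_adj : ∀ j < t, G.Adj (x j) (x (j + 1))
  path_col : ∀ j < t, c s(x j, x (j + 1)) = some (if Even j then κ₁ else κ₂)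

/-- `z` is a vertex of the Vizing chain `C`. -/
def VizingChain.HasVertex {G : SimpleGraph V} {c : Sym2 V → Option ℕ}
    (C : VizingChain G c) (z : V) : Prop :=
  z = C.u ∨ (∃ i < C.k, z = C.w i) ∨ (∃ j ≤ C.t, z = C.x j)

/-- The 1-hop neighbourhood of a subgraph `H`: all vertices of `G` at distance at most
`1` from a vertex of `H`. -/
def hopNbhd (G : SimpleGraph V) (H : G.Subgraph) : Set V :=
  {y | ∃ z ∈ H.verts, y = z ∨ G.Adj y z}

/-- Given a colouring `c₀`, the set of `H`-reaching vertices outside `N¹(H)`: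
vertices `z ∉ N¹(H)` on which some Vizing chain containing a vertex of `H`
is constructed. -/
def reachingSet (G : SimpleGraph V) (H : G.Subgraph) (c₀ : Sym2 V → Option ℕ) :
    Set V :=
  {z | z ∉ hopNbhd G H ∧
    ∃ C : VizingChain G c₀, C.u = z ∧ ∃ y, C.HasVertex y ∧ y ∈ H.verts}

/-- An alternating path: its edges receive the colours `κ₁`, `κ₂`, `κ₁`, … in turn. -/
def IsAlternating (c : Sym2 V → Option ℕ) (κ₁ κ₂ : ℕ) (x : ℕ → V) (t : ℕ) : Prop :=
  ∀ j < t, c s(x j, x (j + 1)) = some (if Even j then κ₁ else κ₂)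

theorem IsProperPartial.eq_of_color_eq {G : SimpleGraph V} {c : Sym2 V → Option ℕ}
    (hc : IsProperPartial G c) {a b z : V} {κ : ℕ}
    (ha : c s(a, z) = some κ) (hb : c s(b, z) = some κ) : a = b := by
  by_contra hab
  refine hc.2 s(a, z) s(b, z) κ (fun h => hab ?_) ⟨z, by simp, by simp⟩ ha hb
  exact Sym2.congr_left.mp h

theorem IsProperPartialVizing.mem_Icc {G : SimpleGraph V} [Fintype V] [DecidableRel G.Adj]
    {c : Sym2 V → Option ℕ} (hc : IsProperPartialVizing G c) {e : Sym2 V} {κ : ℕ}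
    (h : c e = some κ) : κ ∈ Finset.Icc 1 (G.maxDegree + 1) :=
  Finset.mem_Icc.2 ⟨(hc.1.1 e κ h).2, hc.2 e κ h⟩

/-- Away from the vertices of `H`, availability only depends on the colours outside `H`. -/
theorem Available.of_agree {G : SimpleGraph V} {H : G.Subgraph} {c c' : Sym2 V → Option ℕ}
    (hagree : ∀ e, e ∉ H.edgeSet → c e = c' e) {v : V} (hv : v ∉ H.verts) {κ : ℕ}
    (h : Available G c v κ) : Available G c' v κ := by
  intro x hx
  rw [← hagree]
  · exact h x hx
  · exact fun he => hv (H.edge_vert (H.mem_edgeSet.1 he))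

theorem exists_available_mem_Icc {G : SimpleGraph V} [Fintype V] [DecidableRel G.Adj]
    (c : Sym2 V → Option ℕ) (v : V) :
    ∃ κ ∈ Finset.Icc 1 (G.maxDegree + 1), Available G c v κ := by
  classical
  have hcard : ((G.neighborFinset v).image fun x => (c s(v, x)).getD 0).card <
      (Finset.Icc 1 (G.maxDegree + 1)).card := by
    calc _ ≤ (G.neighborFinset v).card := Finset.card_image_le
      _ ≤ G.maxDegree := by simpa using G.degree_le_maxDegree v
      _ < _ := by simp
  obtain ⟨κ, hκ, hκ'⟩ := Finset.exists_mem_notMem_of_card_lt_card hcard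
  refine ⟨κ, hκ, fun x hx hcx => hκ' ?_⟩
  exact Finset.mem_image.2 ⟨x, by simpa using hx, by simp [hcx]⟩

/-- An alternating path that starts at a vertex missing its second colour is determined, as far as
its start is concerned, by its end and the parity of its length. -/
theorem IsAlternating.start_eq_of_le {G : SimpleGraph V} {c : Sym2 V → Option ℕ}
    (hc : IsProperPartial G c) {κ₁ κ₂ : ℕ} {x y : ℕ → V} {s t : ℕ}
    (hx : IsAlternating c κ₁ κ₂ x s) (hy : IsAlternating c κ₁ κ₂ y t)
    (hav : Available G c (x 0) κ₂) (hend : x s = y t) (hpar : Even s ↔ Even t) (hst : s ≤ t) :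
    x 0 = y 0 := by
  have key : ∀ i ≤ s, x (s - i) = y (t - i) := by
    intro i
    induction i with
    | zero => intro _; simpa using hend
    | succ i ih =>
      intro hi
      have h1 := hx (s - (i + 1)) (by omega)
      have h2 := hy (t - (i + 1)) (by omega)
      rw [show s - (i + 1) + 1 = s - i by omega, ih (by omega)] at h1
      rw [show t - (i + 1) + 1 = t - i by omega] at h2
      have hp : Even (s - (i + 1)) ↔ Even (t - (i + 1)) := by
        rw [Nat.even_sub hi, Nat.even_sub (hi.trans hst), hpar]
      rw [← if_congr hp rfl rfl] at h2
      exact hc.eq_of_color_eq h1 h2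
  have h0 : x 0 = y (t - s) := by simpa using key s le_rfl
  have hev : Even (t - s) := by rw [Nat.even_sub hst]; exact hpar.symm
  rcases Nat.eq_zero_or_pos (t - s) with h | h
  · rw [h0, h]
  · exfalso
    have h1 := hy (t - s - 1) (by omega)
    have hodd : ¬ Even (t - s - 1) := by
      rw [Nat.even_sub h]
      simp [hev]
    rw [if_neg hodd, show t - s - 1 + 1 = t - s by omega, ← h0, Sym2.eq_swap] at h1
    exact hav _ (hc.1 _ _ h1).1 h1

theorem IsAlternating.start_eq {G : SimpleGraph V} {c : Sym2 V → Option ℕ}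
    (hc : IsProperPartial G c) {κ₁ κ₂ : ℕ} {x y : ℕ → V} {s t : ℕ}
    (hx : IsAlternating c κ₁ κ₂ x s) (hy : IsAlternating c κ₁ κ₂ y t)
    (havx : Available G c (x 0) κ₂) (havy : Available G c (y 0) κ₂)
    (hend : x s = y t) (hpar : Even s ↔ Even t) : x 0 = y 0 := by
  rcases le_total s t with h | h
  · exact hx.start_eq_of_le hc hy havx hend hpar h
  · exact (hy.start_eq_of_le hc hx havy hend.symm hpar.symm h).symm

theorem VizingChain.adj_start {G : SimpleGraph V} {c : Sym2 V → Option ℕ}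
    (C : VizingChain G c) : G.Adj C.u (C.x 0) := by
  rw [C.x0]
  exact C.fan.2.1 _ (Nat.sub_lt C.k_pos one_pos)

/-- Fan vertices lie outside `H` when the center lies outside its 1-hop neighbourhood. -/
theorem notMem_verts_of_adj {G : SimpleGraph V} {H : G.Subgraph} {u w : V}
    (hu : u ∉ hopNbhd G H) (h : G.Adj u w) : w ∉ H.verts :=
  fun hw => hu ⟨w, hw, Or.inr h⟩

theorem center_notMem_verts {G : SimpleGraph V} {H : G.Subgraph} {u : V}
    (hu : u ∉ hopNbhd G H) : u ∉ H.verts :=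
  fun h => hu ⟨u, h, Or.inl rfl⟩

/-- A chain reaching `H` can be cut off at its first vertex in `H`, which is on its path. -/
theorem exists_chain_first_hit {G : SimpleGraph V} {H : G.Subgraph} {c : Sym2 V → Option ℕ}
    {z : V} (hz : z ∈ reachingSet G H c) :
    ∃ C : VizingChain G c, C.u = z ∧ C.x C.t ∈ H.verts ∧ ∀ j < C.t, C.x j ∉ H.verts := by
  classical
  obtain ⟨hN, C, rfl, y, hy, hyH⟩ := hz
  have hex : ∃ j, j ≤ C.t ∧ C.x j ∈ H.verts := by
    rcases hy with rfl | ⟨i, hi, rfl⟩ | ⟨j, hj, rfl⟩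
    · exact absurd hyH (center_notMem_verts hN)
    · exact absurd hyH (notMem_verts_of_adj hN (C.fan.2.1 i hi))
    · exact ⟨j, hj, hyH⟩
  obtain ⟨hle, hmem⟩ := Nat.find_spec hex
  refine ⟨{ C with
    t := Nat.find hex
    path_inj := C.path_inj.mono (Set.Iic_subset_Iic.2 hle)
    path_adj := fun j hj => C.path_adj j (hj.trans_le hle)
    path_col := fun j hj => C.path_col j (hj.trans_le hle) }, rfl, hmem, ?_⟩
  intro j hj h
  exact Nat.find_min hex hj ⟨hj.le.trans hle, h⟩

theorem reachingSet_subset_of_agree {G : SimpleGraph V} {H : G.Subgraph}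
    {c c' : Sym2 V → Option ℕ} (hagree : ∀ e, e ∉ H.edgeSet → c e = c' e) :
    reachingSet G H c ⊆ reachingSet G H c' := by
  intro z hz
  have hN := hz.1
  obtain ⟨C, rfl, hend, hbefore⟩ := exists_chain_first_hit hz
  have hcol : ∀ a b, a ∉ H.verts → c' s(a, b) = c s(a, b) := fun a b ha =>
    (hagree _ fun he => ha (H.edge_vert (H.mem_edgeSet.1 he))).symm
  have hu := center_notMem_verts hN
  have hw : ∀ i < C.k, C.w i ∉ H.verts := fun i hi =>
    notMem_verts_of_adj hN (C.fan.2.1 i hi)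
  refine ⟨hN, { C with
    fan := ⟨C.fan.1, C.fan.2.1, ?_, ?_⟩
    avail₁ := C.avail₁.of_agree hagree hu
    avail₂ := C.avail₂.of_agree hagree (hw _ (Nat.sub_lt C.k_pos one_pos))
    path_col := ?_ }, rfl, C.x C.t, Or.inr (Or.inr ⟨C.t, le_rfl, rfl⟩), hend⟩
  · rw [hcol _ _ hu]
    exact C.fan.2.2.1
  · intro i hi
    obtain ⟨β, h1, h2⟩ := C.fan.2.2.2 i hi
    exact ⟨β, by rw [hcol _ _ hu, h1], h2.of_agree hagree (hw i (by omega))⟩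
  · intro j hj
    rw [hcol _ _ (hbefore j hj)]
    exact C.path_col j hj

/-- Centers adjacent to the start of an alternating path with prescribed end, colours and
parity of length. -/
def alternatingCenters (G : SimpleGraph V) (c : Sym2 V → Option ℕ) (h : V) (κ₁ κ₂ : ℕ)
    (p : Bool) : Set V :=
  {u | ∃ x t, IsAlternating c κ₁ κ₂ x t ∧ Available G c (x 0) κ₂ ∧ x t = h ∧
    (Even t ↔ p = true) ∧ G.Adj u (x 0)}

theorem ncard_alternatingCenters_le [Fintype V] {G : SimpleGraph V} [DecidableRel G.Adj]
    {c : Sym2 V → Option ℕ} (hc : IsProperPartial G c) (h : V) (κ₁ κ₂ : ℕ) (p : Bool) :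
    (alternatingCenters G c h κ₁ κ₂ p).ncard ≤ G.maxDegree := by
  rcases (alternatingCenters G c h κ₁ κ₂ p).eq_empty_or_nonempty with
    he | ⟨-, x, t, hx, hav, hend, hp, -⟩
  · simp [he]
  · have hsub : alternatingCenters G c h κ₁ κ₂ p ⊆ G.neighborFinset (x 0) := by
      rintro u ⟨y, s, hy, hav', hend', hp', hadj⟩
      rw [hy.start_eq hc hx hav' hav (hend'.trans hend.symm) (hp'.trans hp.symm)] at hadj
      simpa using hadj.symm
    calc _ ≤ (G.neighborFinset (x 0) : Set V).ncard := Set.ncard_le_ncard hsub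
      _ = G.degree (x 0) := by rw [Set.ncard_coe_finset, G.card_neighborFinset_eq_degree]
      _ ≤ _ := G.degree_le_maxDegree _

theorem exists_mem_alternatingCenters [Fintype V] {G : SimpleGraph V} [DecidableRel G.Adj]
    {H : G.Subgraph} {c : Sym2 V → Option ℕ} (hc : IsProperPartialVizing G c) {z : V}
    (hz : z ∈ reachingSet G H c) :
    ∃ h ∈ H.verts, ∃ κ₁ ∈ Finset.Icc 1 (G.maxDegree + 1),
      ∃ κ₂ ∈ Finset.Icc 1 (G.maxDegree + 1), ∃ p, z ∈ alternatingCenters G c h κ₁ κ₂ p := by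
  obtain ⟨C, rfl, hend, -⟩ := exists_chain_first_hit hz
  have ht : 0 < C.t := by
    by_contra ht
    rw [Nat.eq_zero_of_not_pos ht] at hend
    exact notMem_verts_of_adj hz.1 C.adj_start hend
  have h₁ : C.κ₁ ∈ Finset.Icc 1 (G.maxDegree + 1) :=
    hc.mem_Icc (by simpa using C.path_col 0 ht)
  obtain ⟨κ₂, h₂, hav, halt⟩ : ∃ κ₂ ∈ Finset.Icc 1 (G.maxDegree + 1),
      Available G c (C.x 0) κ₂ ∧ IsAlternating c C.κ₁ κ₂ C.x C.t := by
    by_cases ht1 : 1 < C.t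
    · exact ⟨C.κ₂, hc.mem_Icc (by simpa using C.path_col 1 ht1), C.x0 ▸ C.avail₂, C.path_col⟩
    · obtain ⟨κ₂, h₂, hav⟩ := exists_available_mem_Icc (G := G) c (C.x 0)
      refine ⟨κ₂, h₂, hav, fun j hj => ?_⟩
      obtain rfl : j = 0 := by omega
      simpa using C.path_col 0 hj
  exact ⟨_, hend, _, h₁, κ₂, h₂, decide (Even C.t), C.x, C.t, halt, hav, rfl, by simp,
    C.adj_start⟩

theorem ncard_reachingSet_le [Fintype V] {G : SimpleGraph V} [DecidableRel G.Adj]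
    (H : G.Subgraph) {c : Sym2 V → Option ℕ} (hc : IsProperPartialVizing G c) :
    (reachingSet G H c).ncard ≤ 2 * (G.maxDegree + 1) ^ 3 * H.verts.ncard := by
  classical
  set I := Finset.Icc 1 (G.maxDegree + 1)
  set S : Finset (V × ℕ × ℕ × Bool) := H.verts.toFinset ×ˢ I ×ˢ I ×ˢ Finset.univ
  set T : V × ℕ × ℕ × Bool → Finset V := fun q =>
    (alternatingCenters G c q.1 q.2.1 q.2.2.1 q.2.2.2).toFinset
  have hT : ∀ q ∈ S, (T q).card ≤ G.maxDegree := fun q _ => by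
    rw [← Set.ncard_eq_toFinset_card']
    exact ncard_alternatingCenters_le hc.1 _ _ _ _
  have hsub : reachingSet G H c ⊆ S.biUnion T := by
    intro z hz
    obtain ⟨h, hh, κ₁, h₁, κ₂, h₂, p, hp⟩ := exists_mem_alternatingCenters hc hz
    rw [Finset.mem_coe, Finset.mem_biUnion]
    refine ⟨(h, κ₁, κ₂, p), ?_, by simpa [T] using hp⟩
    simp only [S, Finset.mem_product, Set.mem_toFinset, Finset.mem_univ]
    exact ⟨hh, h₁, h₂, trivial⟩
  calc (reachingSet G H c).ncard ≤ (S.biUnion T : Set V).ncard := Set.ncard_le_ncard hsub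
    _ = (S.biUnion T).card := Set.ncard_coe_finset _
    _ ≤ S.card * G.maxDegree := Finset.card_biUnion_le_card_mul _ _ _ hT
    _ = 2 * ((G.maxDegree + 1) ^ 2 * G.maxDegree) * H.verts.ncard := by
      rw [Set.ncard_eq_toFinset_card']
      simp only [S, I, Finset.card_product, Nat.card_Icc, Finset.card_univ, Fintype.card_bool,
        Nat.add_sub_cancel]
      ring
    _ ≤ 2 * (G.maxDegree + 1) ^ 3 * H.verts.ncard := by
      rw [pow_succ _ 2]
      gcongr
      exact Nat.le_succ _

/-- **Reaching lemma.** If the proper partial `(Δ+1)`-edge colourings `c` and `c'`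
differ only on a subgraph `H`, then the same vertices outside `N¹(H)` can reach `H` via
a Vizing chain under `c` and under `c'`, and there are at most `2 (Δ+1)³ |V(H)|` such
vertices. -/
theorem vizing_chain_reaching (V : Type*) [Fintype V] [DecidableEq V]
    (G : SimpleGraph V) [DecidableRel G.Adj] (H : G.Subgraph)
    (c c' : Sym2 V → Option ℕ)
    (hc : IsProperPartialVizing G c) (hc' : IsProperPartialVizing G c')
    (hagree : ∀ e, e ∉ H.edgeSet → c e = c' e) :
    reachingSet G H c = reachingSet G H c' ∧
    (reachingSet G H c).ncard ≤ 2 * (G.maxDegree + 1) ^ 3 * H.verts.ncard := by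
  exact ⟨(reachingSet_subset_of_agree hagree).antisymm
    (reachingSet_subset_of_agree fun e he => (hagree e he).symm), ncard_reachingSet_le H hc⟩
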